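/- Let (t_n)_{n≥0} be the Thue–Morse sequence and (b_n)_{n≥1} the paperfolding sequence. For every integer k ≥ 1, ζ(2k+1) − (2^(2k−1)·|E_{2k}|/(2k)!)·π^(2k+1) = ∑_{n≥1} N(n;k)/n^(2k+1), where N(n;k) = (2^(4k+1) − 2^(2k))·(2b_n − 1) + 2^(−(2k+1))·((2^(2k+1)+1)·t_{n−1} + (2^(2k+1)−1)·t_n). -/

import Mathlib

/-- Even-index Euler numbers: `E2 k = E_{2k}`, where `1/cosh t = ∑ E_n t^n/n!`
(equivalently, `E_0 = 1`, odd-index Euler numbers vanish, and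
`∑_{j≤n} C(2n,2j) E_{2j} = 0` for `n ≥ 1`). -/
def E2 : ℕ → ℤ
  | 0 => 1
  | n + 1 => -∑ k ∈ (Finset.range (n+1)).attach,
      ((2*(n+1)).choose (2*k.1) : ℤ) * E2 k.1
decreasing_by exact Finset.mem_range.mp k.2

/-- Thue–Morse sequence: `tm 0 = 0`, `tm (2n) = tm n`, `tm (2n+1) = 1 - tm n`. -/
def tm : ℕ → ℕ
  | 0 => 0
  | n + 1 => if (n+1) % 2 = 0 then tm ((n+1)/2) else 1 - tm ((n+1)/2)
decreasing_by all_goals exact Nat.div_lt_self (Nat.succ_pos n) one_lt_two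

/-- Paperfolding (dragon-curve) sequence: `pf (2n) = pf n`, `pf (4n+1) = 0`,
`pf (4n+3) = 1` (with `pf 0 = 0`). -/
def pf : ℕ → ℕ
  | 0 => 0
  | n + 1 => if (n+1) % 2 = 0 then pf ((n+1)/2) else if (n+1) % 4 = 1 then 0 else 1
decreasing_by exact Nat.div_lt_self (Nat.succ_pos n) one_lt_two

open Finset in
theorem sum_range_two_mul_eq_sum_even_add_odd {M : Type*} [AddCommMonoid M] (f : ℕ → M) (n : ℕ) :
    ∑ i ∈ range (2 * n), f i = ∑ i ∈ range n, (f (2 * i) + f (2 * i + 1)) := by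
  induction n with
  | zero => simp
  | succ n ih =>
    rw [show 2 * (n + 1) = 2 * n + 1 + 1 by ring, sum_range_succ, sum_range_succ, ih,
      sum_range_succ, add_assoc]

namespace Polynomial

open Finset

theorem hasseDeriv_bernoulli {n m : ℕ} (h : m ≤ n) :
    hasseDeriv m (bernoulli n) = (n.choose m : ℚ) • bernoulli (n - m) := by
  ext i
  rw [hasseDeriv_coeff, coeff_smul, coeff_bernoulli, coeff_bernoulli]
  by_cases hi : i + m ≤ n
  · have hc := Nat.choose_mul (n := n) (k := i + m) (s := m) (by omega)
    rw [Nat.add_sub_cancel] at hc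
    have hc' : (n.choose (i + m) : ℚ) * ((i + m).choose m) = n.choose m * (n - m).choose i :=
      mod_cast hc
    rw [if_pos hi, if_pos (by omega), smul_eq_mul, show n - (i + m) = n - m - i by omega]
    linear_combination _root_.bernoulli (n - m - i) * hc'
  · rw [if_neg hi, if_neg (by omega)]
    simp

theorem natDegree_bernoulli_le (n : ℕ) : (bernoulli n).natDegree ≤ n := by
  rw [natDegree_le_iff_coeff_eq_zero]
  intro i hi
  rw [coeff_bernoulli, if_neg (by omega)]

theorem bernoulli_eval_add (n : ℕ) (x y : ℚ) :
    (bernoulli n).eval (x + y) =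
      ∑ k ∈ range (n + 1), n.choose k * (bernoulli k).eval x * y ^ (n - k) := by
  rw [add_comm x y, ← taylor_eval, eval_eq_sum_range' (n := n + 1)
    (by rw [natDegree_taylor]; exact Nat.lt_succ_of_le (natDegree_bernoulli_le n)),
    ← sum_range_reflect]
  refine sum_congr rfl fun k hk => ?_
  have hk' : k ≤ n := Nat.lt_succ_iff.mp (mem_range.mp hk)
  rw [Nat.add_sub_cancel, taylor_coeff, hasseDeriv_bernoulli (Nat.sub_le n k), eval_smul,
    smul_eq_mul, Nat.choose_symm hk', Nat.sub_sub_self hk']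

theorem sum_choose_mul_bernoulli_eval_one_quarter {n : ℕ} (hn : 1 ≤ n) :
    ∑ i ∈ range (n + 1), ((2 * n + 1).choose (2 * i + 1) : ℚ) *
      (bernoulli (2 * i + 1)).eval (1 / 4) * (1 / 4) ^ (2 * (n - i)) = 0 := by
  have h₀ : (bernoulli (2 * n + 1)).eval (1 / 4 + -(1 / 4)) = 0 := by
    rw [add_neg_cancel, bernoulli_eval_zero,
      bernoulli_eq_zero_of_odd (odd_two_mul_add_one n) (by omega)]
  have h₁ : (bernoulli (2 * n + 1)).eval (1 / 4 + 1 / 4) = 0 := by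
    have h := bernoulli_eval_one_sub (2 * n + 1) (1 / 2)
    rw [(odd_two_mul_add_one n).neg_one_pow] at h
    norm_num at h ⊢
    linarith
  rw [bernoulli_eval_add] at h₀ h₁
  have h : ∑ k ∈ range (2 * (n + 1)), ((2 * n + 1).choose k : ℚ) * (bernoulli k).eval (1 / 4) *
      ((1 / 4) ^ (2 * n + 1 - k) + (-(1 / 4)) ^ (2 * n + 1 - k)) = 0 := by
    simp only [mul_add, sum_add_distrib]
    exact (congrArg₂ _ h₁ h₀).trans (add_zero 0)
  rw [sum_range_two_mul_eq_sum_even_add_odd] at h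
  have h2 : (2 : ℚ) * ∑ i ∈ range (n + 1), ((2 * n + 1).choose (2 * i + 1) : ℚ) *
      (bernoulli (2 * i + 1)).eval (1 / 4) * (1 / 4) ^ (2 * (n - i)) = 0 := by
    rw [← h, mul_sum]
    refine sum_congr rfl fun i hi => ?_
    have hi' : i ≤ n := Nat.lt_succ_iff.mp (mem_range.mp hi)
    rw [show 2 * n + 1 - 2 * i = 2 * (n - i) + 1 by omega,
      show 2 * n + 1 - (2 * i + 1) = 2 * (n - i) by omega,
      (odd_two_mul_add_one (n - i)).neg_pow, (even_two_mul (n - i)).neg_pow]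
    ring
  simpa using h2

end Polynomial

theorem E2_eq_bernoulli_eval (k : ℕ) :
    (E2 k : ℚ) = -(4 ^ (2 * k + 1) / (2 * k + 1)) *
      (Polynomial.bernoulli (2 * k + 1)).eval (1 / 4) := by
  induction k using Nat.strong_induction_on with
  | _ k ih =>
    obtain _ | n := k
    · simp [E2, Polynomial.bernoulli_one]; norm_num
    have h := Polynomial.sum_choose_mul_bernoulli_eval_one_quarter (n := n + 1) (by omega)
    have hterm : ∀ i ∈ Finset.range (n + 2), ((2 * (n + 1)).choose (2 * i) : ℚ) *
        (-(4 ^ (2 * i + 1) / (2 * i + 1)) * (Polynomial.bernoulli (2 * i + 1)).eval (1 / 4)) =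
        -(4 ^ (2 * (n + 1) + 1) / (2 * (n + 1 : ℕ) + 1)) *
          (((2 * (n + 1) + 1).choose (2 * i + 1) : ℚ) *
          (Polynomial.bernoulli (2 * i + 1)).eval (1 / 4) * (1 / 4) ^ (2 * (n + 1 - i))) := by
      intro i hi
      obtain ⟨d, hd⟩ := Nat.exists_eq_add_of_le (Nat.lt_succ_iff.mp (Finset.mem_range.mp hi))
      have hc : ((2 * (n + 1 : ℕ) + 1 : ℚ)) * (2 * (n + 1)).choose (2 * i) =
          (2 * (n + 1) + 1).choose (2 * i + 1) * (2 * i + 1) :=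
        mod_cast Nat.add_one_mul_choose_eq (2 * (n + 1)) (2 * i)
      have hp : (4 : ℚ) ^ (2 * (n + 1) + 1) * (1 / 4) ^ (2 * (n + 1 - i)) = 4 ^ (2 * i + 1) := by
        rw [hd, Nat.add_sub_cancel_left, show 2 * (i + d) + 1 = 2 * i + 1 + 2 * d by ring, pow_add,
          mul_assoc, ← mul_pow]
        norm_num
      rw [← hp]
      field_simp
      linear_combination -(Polynomial.bernoulli (2 * i + 1)).eval (1 / 4) * hc
    have hsum : ∑ i ∈ Finset.range (n + 2), ((2 * (n + 1)).choose (2 * i) : ℚ) *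
        (-(4 ^ (2 * i + 1) / (2 * i + 1)) * (Polynomial.bernoulli (2 * i + 1)).eval (1 / 4)) =
        0 := by
      rw [Finset.sum_congr rfl hterm, ← Finset.mul_sum, h, mul_zero]
    rw [Finset.sum_range_succ, Nat.choose_self, Nat.cast_one, one_mul] at hsum
    rw [E2]
    push_cast
    rw [Finset.sum_attach (Finset.range (n + 1))
      (fun i => ((2 * (n + 1)).choose (2 * i) : ℚ) * (E2 i : ℚ)),
      Finset.sum_congr rfl fun i hi => by rw [ih i (Finset.mem_range.mp hi)]]
    push_cast at hsum
    linarith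

theorem tm_le_one (n : ℕ) : tm n ≤ 1 := by
  induction n using Nat.strong_induction_on with
  | _ n ih =>
    obtain _ | n := n
    · simp [tm]
    rw [tm]
    split_ifs
    · exact ih _ (by omega)
    · omega

theorem tm_two_mul (n : ℕ) : tm (2 * n) = tm n := by
  obtain _ | n := n
  · rfl
  rw [show 2 * (n + 1) = 2 * n + 1 + 1 by ring, tm, if_pos (by omega)]
  congr 1
  omega

theorem tm_two_mul_add_one (n : ℕ) : (tm (2 * n + 1) : ℝ) = 1 - tm n := by
  rw [tm, if_neg (by omega), show (2 * n + 1) / 2 = n by omega, Nat.cast_sub (tm_le_one n),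
    Nat.cast_one]

theorem pf_le_one (n : ℕ) : pf n ≤ 1 := by
  induction n using Nat.strong_induction_on with
  | _ n ih =>
    obtain _ | n := n
    · simp [pf]
    rw [pf]
    split_ifs
    · exact ih _ (by omega)
    all_goals omega

theorem pf_two_mul (n : ℕ) : pf (2 * n) = pf n := by
  obtain _ | n := n
  · rfl
  rw [show 2 * (n + 1) = 2 * n + 1 + 1 by ring, pf, if_pos (by omega)]
  congr 1
  omega

theorem pf_four_mul_add_one (n : ℕ) : pf (4 * n + 1) = 0 := by
  rw [pf, if_neg (by omega), if_pos (by omega)]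

theorem pf_four_mul_add_three (n : ℕ) : pf (4 * n + 3) = 1 := by
  rw [pf, if_neg (by omega), if_neg (by omega)]

theorem Summable.tsum_eq_tsum_even_add_tsum_odd {f : ℕ → ℝ} (hf : Summable f) :
    ∑' n, f n = ∑' n, f (2 * n) + ∑' n, f (2 * n + 1) :=
  (tsum_even_add_odd (hf.comp_injective fun _ _ h => by simpa using h)
    (hf.comp_injective fun _ _ h => by simpa using h)).symm

theorem summable_div_pow_of_abs_le_one {s : ℕ} (hs : 1 < s) {c : ℕ → ℝ} (hc : ∀ n, |c n| ≤ 1) :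
    Summable fun n : ℕ => c n / (n : ℝ) ^ s := by
  refine .of_norm_bounded (Real.summable_one_div_nat_pow.mpr hs) fun n => ?_
  rw [Real.norm_eq_abs, abs_div, abs_of_nonneg (by positivity : (0 : ℝ) ≤ (n : ℝ) ^ s)]
  gcongr
  exact hc n

theorem two_mul_div_pow (c : ℝ) (n s : ℕ) :
    c / ((2 * n : ℕ) : ℝ) ^ s = (1 / 2 ^ s) * (c / (n : ℝ) ^ s) := by
  push_cast
  rw [mul_pow, div_mul_div_comm, one_mul]

theorem abs_tm_le_one (n : ℕ) : |(tm n : ℝ)| ≤ 1 := by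
  rw [Nat.abs_cast]
  exact mod_cast tm_le_one n

theorem abs_two_mul_pf_sub_one_le_one (n : ℕ) : |2 * (pf n : ℝ) - 1| ≤ 1 := by
  have h : (pf n : ℝ) ≤ 1 := mod_cast pf_le_one n
  have h' : (0 : ℝ) ≤ pf n := Nat.cast_nonneg _
  rw [abs_le]
  constructor <;> linarith

theorem tsum_tm_combination {s : ℕ} (hs : 1 < s) :
    (1 + 1 / 2 ^ s) * ∑' n : ℕ, (tm (n - 1) : ℝ) / (n : ℝ) ^ s +
      (1 - 1 / 2 ^ s) * ∑' n : ℕ, (tm n : ℝ) / (n : ℝ) ^ s = ∑' n : ℕ, (1 : ℝ) / (n : ℝ) ^ s := by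
  have hA := summable_div_pow_of_abs_le_one hs fun n => abs_tm_le_one (n - 1)
  have hB := summable_div_pow_of_abs_le_one hs abs_tm_le_one
  have hZ := summable_div_pow_of_abs_le_one hs (c := fun _ => 1) (by simp)
  have hinj : Function.Injective fun n : ℕ => 2 * n + 1 := fun _ _ h => by simpa using h
  have eA := hA.tsum_eq_tsum_even_add_tsum_odd
  have eB := hB.tsum_eq_tsum_even_add_tsum_odd
  have eZ := hZ.tsum_eq_tsum_even_add_tsum_odd
  have hA_even : ∀ n : ℕ, (tm (2 * n - 1) : ℝ) / ((2 * n : ℕ) : ℝ) ^ s =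
      (1 / 2 ^ s) * (1 / (n : ℝ) ^ s - (tm (n - 1) : ℝ) / (n : ℝ) ^ s) := by
    intro n
    obtain _ | n := n
    · simp [show s ≠ 0 by omega]
    · rw [two_mul_div_pow, show 2 * (n + 1) - 1 = 2 * n + 1 by omega, tm_two_mul_add_one,
        Nat.add_sub_cancel, sub_div]
  have hB_odd : ∀ n : ℕ, (tm (2 * n + 1) : ℝ) / ((2 * n + 1 : ℕ) : ℝ) ^ s =
      1 / ((2 * n + 1 : ℕ) : ℝ) ^ s - (tm (2 * n + 1 - 1) : ℝ) / ((2 * n + 1 : ℕ) : ℝ) ^ s := by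
    intro n
    rw [tm_two_mul_add_one, Nat.add_sub_cancel, tm_two_mul, sub_div]
  simp only [hA_even] at eA
  simp only [hB_odd, tm_two_mul, two_mul_div_pow] at eB
  simp only [two_mul_div_pow] at eZ
  rw [tsum_mul_left, hZ.tsum_sub hA] at eA
  have hsub := (hZ.comp_injective hinj).tsum_sub (hA.comp_injective hinj)
  simp only [Function.comp_apply] at hsub
  rw [tsum_mul_left, hsub] at eB
  rw [tsum_mul_left] at eZ
  linear_combination eA + eB - eZ

theorem sin_two_pi_mul_even_mul_quarter (n : ℕ) :
    Real.sin (2 * Real.pi * ((2 * n : ℕ) : ℝ) * (1 / 4)) = 0 := by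
  rw [show 2 * Real.pi * ((2 * n : ℕ) : ℝ) * (1 / 4) = n * Real.pi by push_cast; ring,
    Real.sin_nat_mul_pi]

theorem sin_two_pi_mul_four_mul_add_one_mul_quarter (n : ℕ) :
    Real.sin (2 * Real.pi * ((4 * n + 1 : ℕ) : ℝ) * (1 / 4)) = 1 := by
  rw [show 2 * Real.pi * ((4 * n + 1 : ℕ) : ℝ) * (1 / 4) = Real.pi / 2 + n * (2 * Real.pi) by
    push_cast; ring, Real.sin_add_nat_mul_two_pi, Real.sin_pi_div_two]

theorem sin_two_pi_mul_four_mul_add_three_mul_quarter (n : ℕ) :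
    Real.sin (2 * Real.pi * ((4 * n + 3 : ℕ) : ℝ) * (1 / 4)) = -1 := by
  rw [show 2 * Real.pi * ((4 * n + 3 : ℕ) : ℝ) * (1 / 4) =
      Real.pi / 2 + Real.pi + n * (2 * Real.pi) by push_cast; ring,
    Real.sin_add_nat_mul_two_pi, Real.sin_add_pi, Real.sin_pi_div_two]

theorem sin_two_pi_mul_odd_mul_quarter (n : ℕ) :
    Real.sin (2 * Real.pi * ((2 * n + 1 : ℕ) : ℝ) * (1 / 4)) = -(2 * pf (2 * n + 1) - 1) := by
  obtain ⟨m, rfl | rfl⟩ := n.even_or_odd'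
  · rw [show 2 * (2 * m) + 1 = 4 * m + 1 by ring, pf_four_mul_add_one,
      sin_two_pi_mul_four_mul_add_one_mul_quarter]
    norm_num
  · rw [show 2 * (2 * m + 1) + 1 = 4 * m + 3 by ring, pf_four_mul_add_three,
      sin_two_pi_mul_four_mul_add_three_mul_quarter]
    norm_num

theorem summable_sin_quarter_div_pow {s : ℕ} (hs : 1 < s) :
    Summable fun n : ℕ => Real.sin (2 * Real.pi * (n : ℝ) * (1 / 4)) / (n : ℝ) ^ s :=
  summable_div_pow_of_abs_le_one hs fun _ => Real.abs_sin_le_one _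

theorem tsum_pf {s : ℕ} (hs : 1 < s) :
    (1 - 1 / 2 ^ s) * ∑' n : ℕ, (2 * (pf n : ℝ) - 1) / (n : ℝ) ^ s =
      -∑' n : ℕ, Real.sin (2 * Real.pi * (n : ℝ) * (1 / 4)) / (n : ℝ) ^ s := by
  have eP := (summable_div_pow_of_abs_le_one hs
    abs_two_mul_pf_sub_one_le_one).tsum_eq_tsum_even_add_tsum_odd
  have eS := (summable_sin_quarter_div_pow hs).tsum_eq_tsum_even_add_tsum_odd
  simp only [pf_two_mul, two_mul_div_pow] at eP
  simp only [sin_two_pi_mul_even_mul_quarter, sin_two_pi_mul_odd_mul_quarter, zero_div, tsum_zero,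
    neg_div, tsum_neg] at eS
  rw [tsum_mul_left] at eP
  linear_combination eP + eS

theorem tsum_sin_quarter_div_pow_nonneg {s : ℕ} (hs : 1 < s) :
    0 ≤ ∑' n : ℕ, Real.sin (2 * Real.pi * (n : ℝ) * (1 / 4)) / (n : ℝ) ^ s := by
  have hS := summable_sin_quarter_div_pow hs
  have hinj : Function.Injective fun n : ℕ => 2 * n + 1 := fun _ _ h => by simpa using h
  have hO := hS.comp_injective hinj
  have h2 : Function.Injective fun n : ℕ => 2 * n := fun _ _ h => by simpa using h
  rw [hS.tsum_eq_tsum_even_add_tsum_odd]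
  simp only [sin_two_pi_mul_even_mul_quarter, zero_div, tsum_zero, zero_add]
  have e := hO.tsum_eq_tsum_even_add_tsum_odd
  simp only [Function.comp_apply] at e
  have hadd := (hO.comp_injective h2).tsum_add (hO.comp_injective hinj)
  simp only [Function.comp_apply] at hadd
  rw [e, ← hadd]
  refine tsum_nonneg fun n => ?_
  rw [show 2 * (2 * n) + 1 = 4 * n + 1 by ring, show 2 * (2 * n + 1) + 1 = 4 * n + 3 by ring,
    sin_two_pi_mul_four_mul_add_one_mul_quarter, sin_two_pi_mul_four_mul_add_three_mul_quarter,
    neg_div, ← sub_eq_add_neg, sub_nonneg]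
  push_cast
  gcongr
  norm_num

theorem tsum_sin_quarter_div_pow {k : ℕ} (hk : 1 ≤ k) :
    ∑' n : ℕ, Real.sin (2 * Real.pi * (n : ℝ) * (1 / 4)) / (n : ℝ) ^ (2 * k + 1) =
      |(E2 k : ℝ)| / (4 ^ (k + 1) * (2 * k).factorial) * Real.pi ^ (2 * k + 1) := by
  have h := (hasSum_one_div_nat_pow_mul_sin (k := k) (by omega) (x := 1 / 4)
    ⟨by norm_num, by norm_num⟩).tsum_eq
  have hE : (E2 k : ℝ) = -(4 ^ (2 * k + 1) / (2 * k + 1)) *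
      ((Polynomial.bernoulli (2 * k + 1)).map (algebraMap ℚ ℝ)).eval (1 / 4) := by
    have hq : ((Polynomial.bernoulli (2 * k + 1)).map (algebraMap ℚ ℝ)).eval (1 / 4) =
        (((Polynomial.bernoulli (2 * k + 1)).eval (1 / 4) : ℚ) : ℝ) := by
      rw [← eq_ratCast (algebraMap ℚ ℝ), ← Polynomial.eval_map_apply]
      simp
    have h := congrArg (Rat.cast : ℚ → ℝ) (E2_eq_bernoulli_eval k)
    push_cast at h
    rw [hq, h]
  have hval : ∑' n : ℕ, Real.sin (2 * Real.pi * (n : ℝ) * (1 / 4)) / (n : ℝ) ^ (2 * k + 1) =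
      (-1) ^ k * (E2 k : ℝ) * (Real.pi ^ (2 * k + 1) / (4 ^ (k + 1) * (2 * k).factorial)) := by
    simp only [one_div_mul_eq_div] at h
    rw [h, hE, Nat.factorial_succ, show (4 : ℝ) ^ (2 * k + 1) = 2 ^ (2 * k) * 4 ^ (k + 1) by
      rw [pow_mul, show (2 : ℝ) ^ 2 = 4 by norm_num]; ring]
    push_cast
    field_simp
    ring
  have hpos : (0 : ℝ) < Real.pi ^ (2 * k + 1) / (4 ^ (k + 1) * (2 * k).factorial) := by
    positivity
  have hnn := tsum_sin_quarter_div_pow_nonneg (s := 2 * k + 1) (by omega)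
  rw [hval] at hnn ⊢
  have habs : |(E2 k : ℝ)| = (-1) ^ k * (E2 k : ℝ) := by
    rw [← abs_of_nonneg (nonneg_of_mul_nonneg_left hnn hpos), abs_mul, abs_pow, abs_neg, abs_one,
      one_pow, one_mul]
  rw [habs]
  ring

theorem tsum_div_pow_eq_tsum_succ {s : ℕ} (hs : 1 < s) {c : ℕ → ℝ} (hc : ∀ n, |c n| ≤ 1) :
    ∑' n : ℕ, c n / (n : ℝ) ^ s = ∑' n : ℕ, c (n + 1) / ((n : ℝ) + 1) ^ s := by
  rw [(summable_div_pow_of_abs_le_one hs hc).tsum_eq_zero_add]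
  simp [show s ≠ 0 by omega]

theorem summable_succ_div_pow {s : ℕ} (hs : 1 < s) {c : ℕ → ℝ} (hc : ∀ n, |c n| ≤ 1) :
    Summable fun n : ℕ => c (n + 1) / ((n : ℝ) + 1) ^ s := by
  simpa using (summable_nat_add_iff 1).mpr (summable_div_pow_of_abs_le_one hs hc)

theorem zeta_odd_minus_pi_odd (k : ℕ) (hk : 1 ≤ k) :
    (∑' n : ℕ, (1:ℝ) / ((n:ℝ) + 1) ^ (2*k+1))
        - ((2:ℝ) ^ (2*k-1) * |(E2 k : ℝ)| / (Nat.factorial (2*k))) * Real.pi ^ (2*k+1) =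
      ∑' n : ℕ,
        (((2:ℝ) ^ (4*k+1) - 2 ^ (2*k)) * (2 * (pf (n+1) : ℝ) - 1)
          + (2:ℝ) ^ (-(2*(k:ℤ)+1)) *
              (((2:ℝ) ^ (2*k+1) + 1) * (tm n : ℝ) + ((2:ℝ) ^ (2*k+1) - 1) * (tm (n+1) : ℝ)))
          / ((n:ℝ) + 1) ^ (2*k+1) := by
  have hs : 1 < 2 * k + 1 := by omega
  have hA := tsum_div_pow_eq_tsum_succ hs fun n => abs_tm_le_one (n - 1)
  have hB := tsum_div_pow_eq_tsum_succ hs abs_tm_le_one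
  have hZ := tsum_div_pow_eq_tsum_succ hs (c := fun _ => 1) (by simp)
  have hP := tsum_div_pow_eq_tsum_succ hs abs_two_mul_pf_sub_one_le_one
  have sA := summable_succ_div_pow hs fun n => abs_tm_le_one (n - 1)
  have sB := summable_succ_div_pow hs abs_tm_le_one
  have sP := summable_succ_div_pow hs abs_two_mul_pf_sub_one_le_one
  have eT := tsum_tm_combination hs
  have eP := tsum_pf hs
  rw [tsum_sin_quarter_div_pow hk, hP] at eP
  rw [hA, hB, hZ] at eT
  simp only [Nat.add_sub_cancel] at sA eT
  have hz : (2 : ℝ) ^ (-(2 * (k : ℤ) + 1)) = 1 / 2 ^ (2 * k + 1) := by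
    rw [zpow_neg, one_div]
    norm_cast
  have hterm : ∀ n : ℕ,
      (((2:ℝ) ^ (4*k+1) - 2 ^ (2*k)) * (2 * (pf (n+1) : ℝ) - 1)
          + (2:ℝ) ^ (-(2*(k:ℤ)+1)) *
              (((2:ℝ) ^ (2*k+1) + 1) * (tm n : ℝ) + ((2:ℝ) ^ (2*k+1) - 1) * (tm (n+1) : ℝ)))
          / ((n:ℝ) + 1) ^ (2*k+1) =
      2 ^ (4 * k + 1) * (1 - 1 / 2 ^ (2 * k + 1)) *
          ((2 * (pf (n + 1) : ℝ) - 1) / ((n : ℝ) + 1) ^ (2 * k + 1)) +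
        ((1 + 1 / 2 ^ (2 * k + 1)) * ((tm n : ℝ) / ((n : ℝ) + 1) ^ (2 * k + 1)) +
          (1 - 1 / 2 ^ (2 * k + 1)) * ((tm (n + 1) : ℝ) / ((n : ℝ) + 1) ^ (2 * k + 1))) := by
    intro n
    rw [hz]
    field_simp
    ring
  rw [tsum_congr hterm, (sP.mul_left _).tsum_add ((sA.mul_left _).add (sB.mul_left _)),
    (sA.mul_left _).tsum_add (sB.mul_left _), tsum_mul_left, tsum_mul_left, tsum_mul_left, eT,
    mul_assoc, eP]
  have hpow : (2 : ℝ) ^ (4 * k + 1) = 2 ^ (2 * k - 1) * 4 ^ (k + 1) := by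
    rw [show (4 : ℝ) = 2 ^ 2 by norm_num, ← pow_mul, ← pow_add]
    congr 1
    omega
  rw [hpow]
  field_simp
  ring
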